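/- Let P be a probability measure on Ω = Σ^ℕ. Then for every n ≥ 1: lim_{t→∞} (H^t(P) − H^t(P_n)) = 0, where P_n := (1/n)·Σ_{i=0}^{n−1} P∘T^{−i}. -/

import Mathlib

open MeasureTheory Filter
open scoped ENNReal

variable {α : Type*}

/-- The cylinder set of sequences in `Ω = Σ^ℕ` whose first `t` symbols are `v`. -/
def cylinder (t : ℕ) (v : Fin t → α) : Set (ℕ → α) :=
  {ω | ∀ i : Fin t, ω (i : ℕ) = v i}

variable [Fintype α] [Nonempty α] [MeasurableSpace α] [DiscreteMeasurableSpace α]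

/-- `P(v)`, the probability that the source emits the word `v`. -/
noncomputable def wordProb (P : Measure (ℕ → α)) {t : ℕ} (v : Fin t → α) : ℝ :=
  (P (cylinder t v)).toReal

/-- `H^t(P)`, the entropy of the induced distribution on words of length `t`, divided
by `t` (natural logarithm; the convention `0 · log 0 = 0` holds since `Real.log 0 = 0`). -/
noncomputable def Hn (P : Measure (ℕ → α)) (t : ℕ) : ℝ :=
  -(1 / (t : ℝ)) * ∑ v : Fin t → α, wordProb P v * Real.log (wordProb P v)

/-- `d_{TV,t}(P,Q) = Σ_{v ∈ Σ^t} |P(v) − Q(v)|`. -/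
noncomputable def dTVt (P Q : Measure (ℕ → α)) (t : ℕ) : ℝ :=
  ∑ v : Fin t → α, |wordProb P v - wordProb Q v|

/-- `d_TV(P,Q) = sup_{t ∈ ℕ} d_{TV,t}(P,Q)`. -/
noncomputable def dTV (P Q : Measure (ℕ → α)) : ℝ := ⨆ t : ℕ, dTVt P Q t

/-- The shift operator `T` on `Ω = Σ^ℕ`: `T(v₀v₁v₂…) = v₁v₂…`. -/
def shift : (ℕ → α) → (ℕ → α) := fun ω n => ω (n + 1)

/-- `P_n := (1/n) Σ_{i=0}^{n−1} P ∘ T^{−i}` (as a measure on `Ω`). -/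
noncomputable def cesaroAvg (P : Measure (ℕ → α)) (n : ℕ) : Measure (ℕ → α) :=
  (n : ℝ≥0∞)⁻¹ • ∑ i ∈ Finset.range n, P.map (shift^[i])

/-- `P_n := (1/n) Σ_{i=0}^{n−1} P ∘ T^{−i}`, as a finite signed measure on `Ω`. -/
noncomputable def cesaroAvgS (P : Measure (ℕ → α)) [IsFiniteMeasure P] (n : ℕ) :
    SignedMeasure (ℕ → α) :=
  (n : ℝ)⁻¹ • ∑ i ∈ Finset.range n, (P.toSignedMeasure).map (shift^[i])

section FiniteEntropy

variable {ι κ : Type*}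

/-- Subadditivity of `x ↦ -x log x` on nonnegative reals. -/
theorem negMulLog_sum_le (s : Finset ι) (f : ι → ℝ) (hf : ∀ a ∈ s, 0 ≤ f a) :
    Real.negMulLog (∑ a ∈ s, f a) ≤ ∑ a ∈ s, Real.negMulLog (f a) := by
  simp only [Real.negMulLog, neg_mul, Finset.sum_neg_distrib, neg_le_neg_iff, Finset.sum_mul]
  refine Finset.sum_le_sum fun a ha => ?_
  rcases (hf a ha).eq_or_lt with h | h
  · simp [← h]
  · exact mul_le_mul_of_nonneg_left
      (Real.log_le_log h (Finset.single_le_sum hf ha)) h.le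

/-- Splitting a mass into at most `K` parts increases its entropy by at most `log K` times
the mass. -/
theorem sum_negMulLog_le (s : Finset ι) (f : ι → ℝ) (hf : ∀ a ∈ s, 0 ≤ f a) {K : ℝ}
    (hK : 0 < K) (hs : (s.card : ℝ) ≤ K) :
    ∑ a ∈ s, Real.negMulLog (f a) ≤
      Real.negMulLog (∑ a ∈ s, f a) + (∑ a ∈ s, f a) * Real.log K := by
  set p := ∑ a ∈ s, f a with hp
  have hp0 : 0 ≤ p := Finset.sum_nonneg hf
  have key : ∀ a ∈ s, Real.negMulLog (f a) ≤ f a * (Real.log K - Real.log p) + (p / K - f a) := by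
    intro a ha
    rcases (hf a ha).eq_or_lt with h | h
    · simp only [← h, Real.negMulLog_zero, zero_mul, sub_zero, zero_add]
      positivity
    · have hpp : 0 < p := h.trans_le (Finset.single_le_sum hf ha)
      have hlog := Real.log_le_sub_one_of_pos (x := p / (f a * K)) (by positivity)
      rw [Real.log_div hpp.ne' (by positivity), Real.log_mul h.ne' hK.ne'] at hlog
      have hmul := mul_le_mul_of_nonneg_left hlog h.le
      have hcancel : f a * (p / (f a * K) - 1) = p / K - f a := by
        field_simp
      rw [hcancel] at hmul
      rw [Real.negMulLog]
      linarith
  have hsum := Finset.sum_le_sum key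
  rw [Finset.sum_add_distrib, ← Finset.sum_mul, Finset.sum_sub_distrib, Finset.sum_const,
    nsmul_eq_mul, ← hp] at hsum
  have hcard : (s.card : ℝ) * (p / K) ≤ p := by
    calc (s.card : ℝ) * (p / K) ≤ K * (p / K) := by gcongr
      _ = p := by field_simp
  rw [Real.negMulLog]
  linarith

variable [Fintype ι] [Fintype κ] [DecidableEq κ]

/-- The entropy of the image of a distribution is at most that of the distribution. -/
theorem sum_negMulLog_fiber_le (f : ι → ℝ) (hf : ∀ a, 0 ≤ f a) (g : ι → κ) :
    ∑ b, Real.negMulLog (∑ a with g a = b, f a) ≤ ∑ a, Real.negMulLog (f a) := by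
  rw [← Finset.sum_fiberwise Finset.univ g]
  exact Finset.sum_le_sum fun b _ => negMulLog_sum_le _ _ fun a _ => hf a

/-- The image of a distribution under a map with fibers of size at most `K` loses at most
`log K` of entropy. -/
theorem sum_negMulLog_le_fiber (f : ι → ℝ) (hf : ∀ a, 0 ≤ f a) (hf1 : ∑ a, f a = 1) (g : ι → κ)
    {K : ℝ} (hK : 0 < K) (hg : ∀ b, ((Finset.univ.filter fun a => g a = b).card : ℝ) ≤ K) :
    ∑ a, Real.negMulLog (f a) ≤
      ∑ b, Real.negMulLog (∑ a with g a = b, f a) + Real.log K := by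
  have h := Finset.sum_le_sum fun b (_ : b ∈ (Finset.univ : Finset κ)) =>
    sum_negMulLog_le (Finset.univ.filter fun a => g a = b) f (fun a _ => hf a) hK (hg b)
  rwa [Finset.sum_add_distrib, ← Finset.sum_mul, Finset.sum_fiberwise, Finset.sum_fiberwise,
    hf1, one_mul] at h

end FiniteEntropy

section Words

variable {β : Type*}

/-- The subword of length `t` starting at position `i` of a word of length `t + n`. -/
def subword {t n : ℕ} (i : ℕ) (hi : i ≤ n) (w : Fin (t + n) → β) : Fin t → β :=
  fun j => w ⟨i + j, by omega⟩

theorem card_subword_fiber_le [Fintype β] [DecidableEq β] {t n : ℕ} (i : ℕ) (hi : i ≤ n)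
    (v : Fin t → β) :
    (Finset.univ.filter fun w : Fin (t + n) → β => subword i hi w = v).card ≤
      Fintype.card β ^ n := by
  have hcard : (Finset.univ : Finset (Fin n → β)).card = Fintype.card β ^ n := by simp
  rw [← hcard]
  refine Finset.card_le_card_of_injOn
    (fun w k => if (k : ℕ) < i then w ⟨k, by omega⟩ else w ⟨t + k, by omega⟩)
    (fun _ _ => Finset.mem_coe.2 (Finset.mem_univ _)) ?_
  intro w hw w' hw' h
  simp only [Finset.coe_filter, Finset.mem_univ, true_and, Set.mem_ofPred_eq] at hw hw'
  ext ⟨j, hj⟩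
  by_cases h₁ : j < i
  · have := congrFun h ⟨j, by omega⟩
    simpa [h₁] using this
  by_cases h₂ : j < i + t
  · have := congrFun (hw.trans hw'.symm) ⟨j - i, by omega⟩
    simpa [subword, show i + (j - i) = j by omega] using this
  · have := congrFun h ⟨j - t, by omega⟩
    simpa [show ¬ j - t < i by omega, show t + (j - t) = j by omega] using this

theorem card_prod_fiber_le {ι κ μ : Type*} [Fintype ι] [Fintype κ] [DecidableEq μ]
    (g : ι → κ → μ) (b : μ) {m : ℕ}
    (hg : ∀ i, (Finset.univ.filter fun w => g i w = b).card ≤ m) :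
    (Finset.univ.filter fun a : ι × κ => g a.1 a.2 = b).card ≤ Fintype.card ι * m := by
  rw [Finset.card_filter, Fintype.sum_prod_type]
  simp only [← Finset.card_filter]
  simpa using Finset.sum_le_sum fun i (_ : i ∈ (Finset.univ : Finset ι)) => hg i

end Words

theorem shift_iterate_apply {β : Type*} (i : ℕ) (ω : ℕ → β) (k : ℕ) :
    shift^[i] ω k = ω (i + k) := by
  induction i generalizing ω with
  | zero => simp
  | succ i ih => rw [Function.iterate_succ_apply, ih, shift, add_right_comm]

theorem measurable_shift_iterate {β : Type*} [MeasurableSpace β] (i : ℕ) :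
    Measurable (shift^[i] : (ℕ → β) → ℕ → β) :=
  Measurable.iterate (measurable_pi_lambda _ fun k => measurable_pi_apply (k + 1)) i

theorem measurableSet_cylinder {β : Type*} [MeasurableSpace β] [DiscreteMeasurableSpace β]
    {t : ℕ} (v : Fin t → β) : MeasurableSet (cylinder t v) := by
  have : cylinder t v = ⋂ i : Fin t, (fun ω : ℕ → β => ω i) ⁻¹' {v i} := by
    ext ω
    simp [_root_.cylinder]
  rw [this]
  exact MeasurableSet.iInter fun i =>
    measurable_pi_apply _ (MeasurableSet.of_discrete (s := {v i}))

theorem pairwiseDisjoint_cylinder {β : Type*} {t : ℕ} (s : Set (Fin t → β)) :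
    s.PairwiseDisjoint (cylinder t) := by
  intro w _ u _ hne
  refine Set.disjoint_left.2 fun ω hω hmem => hne (funext fun j => ?_)
  exact (hω j).symm.trans (hmem j)

/-- The distribution of the word of length `t` read from position `i` is the image of the
distribution of the initial word of length `t + n`. -/
theorem wordProb_map_shift_iterate [DecidableEq α] (P : Measure (ℕ → α)) [IsFiniteMeasure P]
    {t n : ℕ} (i : ℕ) (hi : i ≤ n) (v : Fin t → α) :
    wordProb (P.map (shift^[i])) v =
      ∑ w : Fin (t + n) → α with subword i hi w = v, wordProb P w := by
  have hunion : shift^[i] ⁻¹' cylinder t v =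
      ⋃ w ∈ Finset.univ.filter (fun w : Fin (t + n) → α => subword i hi w = v),
        cylinder (t + n) w := by
    ext ω
    simp only [Set.mem_preimage, _root_.cylinder, Set.mem_ofPred_eq, shift_iterate_apply,
      Finset.mem_filter, Finset.mem_univ, true_and, Set.mem_iUnion, exists_prop]
    constructor
    · intro h
      exact ⟨fun j => ω j, funext h, fun _ => rfl⟩
    · rintro ⟨w, rfl, h⟩ j
      exact h ⟨i + j, by omega⟩
  rw [wordProb, Measure.map_apply (measurable_shift_iterate i) (measurableSet_cylinder v), hunion,
    measure_biUnion_finset (pairwiseDisjoint_cylinder _) fun w _ => measurableSet_cylinder w,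
    ENNReal.toReal_sum fun w _ => measure_ne_top _ _]
  rfl

theorem wordProb_eq_sum_subword [DecidableEq α] (P : Measure (ℕ → α)) [IsFiniteMeasure P]
    {t : ℕ} (n : ℕ) (v : Fin t → α) :
    wordProb P v =
      ∑ w : Fin (t + n) → α with subword 0 (Nat.zero_le n) w = v, wordProb P w := by
  simpa using wordProb_map_shift_iterate P 0 (Nat.zero_le n) v

theorem wordProb_cesaroAvg {β : Type*} [MeasurableSpace β] (P : Measure (ℕ → β))
    [IsFiniteMeasure P] (n : ℕ) {t : ℕ} (v : Fin t → β) :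
    wordProb (cesaroAvg P n) v = ∑ i : Fin n, wordProb (P.map (shift^[i])) v / n := by
  rw [← Finset.sum_div, Fin.sum_univ_eq_sum_range (fun i => wordProb (P.map (shift^[i])) v)]
  simp only [wordProb, cesaroAvg, Measure.smul_apply, Measure.coe_finsetSum, Finset.sum_apply,
    smul_eq_mul, ENNReal.toReal_mul, ENNReal.toReal_inv, ENNReal.toReal_natCast]
  rw [ENNReal.toReal_sum fun i _ => measure_ne_top _ _]
  ring

theorem sum_wordProb (P : Measure (ℕ → α)) [IsProbabilityMeasure P] (t : ℕ) :
    ∑ v : Fin t → α, wordProb P v = 1 := by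
  have hunion : ⋃ v ∈ (Finset.univ : Finset (Fin t → α)), cylinder t v = Set.univ := by
    refine Set.eq_univ_of_forall fun ω => ?_
    simp only [Finset.mem_univ, Set.iUnion_true, Set.mem_iUnion]
    exact ⟨fun j => ω j, fun _ => rfl⟩
  simp only [wordProb]
  rw [← ENNReal.toReal_sum fun v _ => measure_ne_top _ _,
    ← measure_biUnion_finset (pairwiseDisjoint_cylinder _) fun v _ => measurableSet_cylinder v,
    hunion, measure_univ, ENNReal.toReal_one]

theorem Hn_eq_sum_negMulLog {β : Type*} [Fintype β] [MeasurableSpace β]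
    (P : Measure (ℕ → β)) (t : ℕ) :
    Hn P t = (∑ v : Fin t → β, Real.negMulLog (wordProb P v)) / t := by
  simp only [Hn, Real.negMulLog, neg_mul, Finset.sum_neg_distrib]
  ring

/-- The unnormalized entropies of `P` and of `P_n` differ by a constant independent of `t`:
both are entropies of images of the uniform mixture over `i < n` of the initial word of
length `t + n`. -/
theorem abs_entropy_sub_entropy_cesaroAvg_le (P : Measure (ℕ → α)) [IsProbabilityMeasure P]
    (n : ℕ) (hn : 1 ≤ n) (t : ℕ) :
    |∑ v : Fin t → α, Real.negMulLog (wordProb P v) -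
      ∑ v : Fin t → α, Real.negMulLog (wordProb (cesaroAvg P n) v)| ≤
      Real.log (n * (Fintype.card α : ℝ) ^ n) := by
  classical
  have hn0 : (n : ℝ) ≠ 0 := by positivity
  let f : Fin n × (Fin (t + n) → α) → ℝ := fun a => wordProb P a.2 / n
  let g₀ : Fin n × (Fin (t + n) → α) → Fin t → α := fun a => subword 0 (Nat.zero_le n) a.2
  let g₁ : Fin n × (Fin (t + n) → α) → Fin t → α := fun a => subword a.1 a.1.isLt.le a.2
  have hf : ∀ a, 0 ≤ f a := fun a => div_nonneg ENNReal.toReal_nonneg (Nat.cast_nonneg n)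
  have hf1 : ∑ a, f a = 1 := by
    simp only [f, Fintype.sum_prod_type, ← Finset.sum_div, sum_wordProb]
    simp [hn0]
  have h₀ : ∀ v, ∑ a with g₀ a = v, f a = wordProb P v := by
    intro v
    rw [Finset.sum_filter, Fintype.sum_prod_type]
    simp only [f, g₀, ← Finset.sum_filter, ← Finset.sum_div, ← wordProb_eq_sum_subword]
    simp [hn0]
  have h₁ : ∀ v, ∑ a with g₁ a = v, f a = wordProb (cesaroAvg P n) v := by
    intro v
    rw [Finset.sum_filter, Fintype.sum_prod_type, wordProb_cesaroAvg]
    simp only [f, g₁, ← Finset.sum_filter]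
    refine Finset.sum_congr rfl fun i _ => ?_
    rw [wordProb_map_shift_iterate P (i : ℕ) i.isLt.le, Finset.sum_div]
  have hK : 0 < n * (Fintype.card α : ℝ) ^ n := by
    have : 0 < Fintype.card α := Fintype.card_pos
    positivity
  have hg₀ : ∀ v, ((Finset.univ.filter fun a => g₀ a = v).card : ℝ) ≤
      n * (Fintype.card α : ℝ) ^ n := fun v => by
    exact_mod_cast (card_prod_fiber_le (fun (_ : Fin n) w => subword 0 (Nat.zero_le n) w) v
      fun _ => card_subword_fiber_le 0 (Nat.zero_le n) v).trans_eq (by rw [Fintype.card_fin])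
  have hg₁ : ∀ v, ((Finset.univ.filter fun a => g₁ a = v).card : ℝ) ≤
      n * (Fintype.card α : ℝ) ^ n := fun v => by
    exact_mod_cast (card_prod_fiber_le (fun (i : Fin n) w => subword i i.isLt.le w) v
      fun i => card_subword_fiber_le i i.isLt.le v).trans_eq (by rw [Fintype.card_fin])
  have hle₀ := sum_negMulLog_fiber_le f hf g₀
  have hle₁ := sum_negMulLog_fiber_le f hf g₁
  have hge₀ := sum_negMulLog_le_fiber f hf hf1 g₀ hK hg₀
  have hge₁ := sum_negMulLog_le_fiber f hf hf1 g₁ hK hg₁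
  simp only [h₀] at hle₀ hge₀
  simp only [h₁] at hle₁ hge₁
  rw [abs_sub_le_iff]
  constructor <;> linarith

/-- Lemma 4: for every `n ≥ 1`, `lim_{t→∞} (H^t(P) − H^t(P_n)) = 0`. -/
theorem tendsto_Hn_sub_Hn_cesaroAvg (P : Measure (ℕ → α)) [IsProbabilityMeasure P]
    (n : ℕ) (hn : 1 ≤ n) :
    Tendsto (fun t : ℕ => Hn P t - Hn (cesaroAvg P n) t) atTop (nhds 0) := by
  refine squeeze_zero_norm (fun t => ?_)
    (tendsto_const_div_atTop_nhds_zero_nat (Real.log (n * (Fintype.card α : ℝ) ^ n)))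
  rw [Hn_eq_sum_negMulLog, Hn_eq_sum_negMulLog, ← sub_div, Real.norm_eq_abs, abs_div,
    Nat.abs_cast]
  gcongr
  exact abs_entropy_sub_entropy_cesaroAvg_le P n hn t
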